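/- Let X and Y be nonempty compact metric spaces with 1-Lipschitz functions τ_X : X → ℝ and τ_Y : Y → ℝ, let u : ℕ → X and v : ℕ → Y be sequences with dense range, and let ε > 0. If the Hausdorff distance in ℝ × ℓ^∞ between the images of the timed-Kuratowski maps satisfies hausdorffDist(range κ_{τ_X,u}, range κ_{τ_Y,v}) < ε, then there exists a map F : X → Y such that: (a) |τ_Y(F x) − τ_X(x)| < ε for all x ∈ X (F is almost time preserving); (b) for every y ∈ Y there exists x ∈ X with dist(F x, y) < 2ε (F is almost onto); and (c) |dist(F x₁, F x₂) − dist(x₁, x₂)| < 3ε for all x₁, x₂ ∈ X (F is almost distance preserving). -/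

import Mathlib

open Metric ENNReal

/-- The Kuratowski map of a compact metric space into `ℓ^∞`, defined from a sequence of
points: `x ↦ (n ↦ dist (u n) x)`. -/
noncomputable def kuratowskiMap {X : Type*} [MetricSpace X] [CompactSpace X]
    (u : ℕ → X) (x : X) : lp (fun _ : ℕ => ℝ) ∞ :=
  ⟨fun n => dist (u n) x, memℓp_infty ⟨Metric.diam (Set.univ : Set X), by
    rintro r ⟨n, rfl⟩
    simpa [Real.norm_eq_abs, abs_of_nonneg dist_nonneg] using
      Metric.dist_le_diam_of_mem isCompact_univ.isBounded (Set.mem_univ (u n))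
        (Set.mem_univ x)⟩⟩

/-- The timed-Kuratowski map `x ↦ (τ x, (n ↦ dist (u n) x))` into `ℝ × ℓ^∞`,
where the product carries the max product distance. -/
noncomputable def timedKuratowskiMap {X : Type*} [MetricSpace X] [CompactSpace X]
    (τ : X → ℝ) (u : ℕ → X) (x : X) : ℝ × lp (fun _ : ℕ => ℝ) ∞ :=
  (τ x, kuratowskiMap u x)

/-- The Kuratowski map defined from a sequence with dense range is an isometry. -/
theorem isometry_kuratowskiMap {X : Type*} [MetricSpace X] [CompactSpace X]
    {u : ℕ → X} (hu : DenseRange u) : Isometry (kuratowskiMap u) := by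
  refine Isometry.of_dist_eq fun x y => ?_
  rw [dist_eq_norm]
  apply le_antisymm
  · refine lp.norm_le_of_forall_le dist_nonneg fun n => ?_
    change |dist (u n) x - dist (u n) y| ≤ dist x y
    simpa only [dist_comm (u n)] using abs_dist_sub_le x y (u n)
  · have key : ∀ z : X, dist z y - dist z x ≤ ‖kuratowskiMap u x - kuratowskiMap u y‖ := by
      intro z
      refine hu.induction_on z (isClosed_le (by fun_prop) continuous_const) fun n => ?_
      have hn := lp.norm_apply_le_norm ENNReal.top_ne_zero
        (kuratowskiMap u x - kuratowskiMap u y) n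
      change |dist (u n) x - dist (u n) y| ≤ _ at hn
      linarith [neg_abs_le (dist (u n) x - dist (u n) y)]
    simpa using key x

theorem isBounded_range_timedKuratowskiMap {X : Type*} [MetricSpace X] [CompactSpace X]
    {τ : X → ℝ} (hτ : Continuous τ) {u : ℕ → X} (hu : DenseRange u) :
    Bornology.IsBounded (Set.range (timedKuratowskiMap τ u)) :=
  (isCompact_range (hτ.prodMk (isometry_kuratowskiMap hu).continuous)).isBounded

/-- If the Hausdorff distance in `ℝ × ℓ^∞` between the images of two timed-Kuratowski maps
is less than `ε`, then there is a map `F : X → Y` that is almost time preserving,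
almost onto, and almost distance preserving. -/
theorem timedKuratowski_hausdorffDist_lt_almost_isometry {X Y : Type*}
    [MetricSpace X] [CompactSpace X] [Nonempty X]
    [MetricSpace Y] [CompactSpace Y] [Nonempty Y]
    (τX : X → ℝ) (τY : Y → ℝ) (hτX : LipschitzWith 1 τX) (hτY : LipschitzWith 1 τY)
    (u : ℕ → X) (v : ℕ → Y) (hu : DenseRange u) (hv : DenseRange v)
    (ε : ℝ) (hε : 0 < ε)
    (h : hausdorffDist (Set.range (timedKuratowskiMap τX u))
        (Set.range (timedKuratowskiMap τY v)) < ε) :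
    ∃ F : X → Y,
      (∀ x : X, |τY (F x) - τX x| < ε) ∧
      (∀ y : Y, ∃ x : X, dist (F x) y < 2 * ε) ∧
      (∀ x₁ x₂ : X, |dist (F x₁) (F x₂) - dist x₁ x₂| < 3 * ε) := by
  have hfin : hausdorffEDist (Set.range (timedKuratowskiMap τX u))
      (Set.range (timedKuratowskiMap τY v)) ≠ ⊤ :=
    hausdorffEDist_ne_top_of_nonempty_of_bounded (Set.range_nonempty _) (Set.range_nonempty _)
      (isBounded_range_timedKuratowskiMap hτX.continuous hu)
      (isBounded_range_timedKuratowskiMap hτY.continuous hv)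
  have hX : ∀ x, ∃ y, dist (timedKuratowskiMap τX u x) (timedKuratowskiMap τY v y) < ε := by
    intro x
    obtain ⟨_, ⟨y, rfl⟩, hy⟩ := exists_dist_lt_of_hausdorffDist_lt (Set.mem_range_self x) h hfin
    exact ⟨y, hy⟩
  have hY : ∀ y, ∃ x, dist (timedKuratowskiMap τX u x) (timedKuratowskiMap τY v y) < ε := by
    intro y
    obtain ⟨_, ⟨x, rfl⟩, hx⟩ :=
      exists_dist_lt_of_hausdorffDist_lt' (Set.mem_range_self y) h hfin
    exact ⟨x, hx⟩
  choose F hF using hX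
  have hspace : ∀ {x y}, dist (timedKuratowskiMap τX u x) (timedKuratowskiMap τY v y) < ε →
      dist (kuratowskiMap u x) (kuratowskiMap v y) < ε :=
    fun hxy => (max_lt_iff.1 hxy).2
  refine ⟨F, fun x => ?_, fun y => ?_, fun x₁ x₂ => ?_⟩
  · rw [abs_sub_comm]
    exact (max_lt_iff.1 (hF x)).1
  · obtain ⟨x, hx⟩ := hY y
    refine ⟨x, ?_⟩
    rw [← (isometry_kuratowskiMap hv).dist_eq]
    linarith [dist_triangle_left (kuratowskiMap v (F x)) (kuratowskiMap v y)
      (kuratowskiMap u x), hspace hx, hspace (hF x)]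
  · rw [← (isometry_kuratowskiMap hv).dist_eq, ← (isometry_kuratowskiMap hu).dist_eq,
      ← Real.dist_eq]
    have hquad := dist_dist_dist_le (kuratowskiMap v (F x₁)) (kuratowskiMap v (F x₂))
      (kuratowskiMap u x₁) (kuratowskiMap u x₂)
    rw [dist_comm (kuratowskiMap v (F x₁)) (kuratowskiMap u x₁),
      dist_comm (kuratowskiMap v (F x₂)) (kuratowskiMap u x₂)] at hquad
    linarith [hspace (hF x₁), hspace (hF x₂)]
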